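/- Let K be a field of characteristic zero and let A be a finite-dimensional non-unital associative K-algebra. Then there exists a commutative K-bialgebra B together with a coaction η : A → A ⊗ B of B on A such that: (i) the pair (B, η) (with B regarded as a commutative algebra) is a universal pair for (A, A); and (ii) for every commutative K-bialgebra C and every coaction ψ : A → A ⊗ C of C on A, there exists a unique bialgebra homomorphism Φ : B → C with ψ = (id_A ⊗ Φ) ∘ η. -/

import Mathlib

/-!
Statement 15: Let `A` be a finite-dimensional non-unital associative algebra over a field
`K` of characteristic zero. Then there exists a commutative `K`-bialgebra `B` with a
coaction `η : A → A ⊗ B` such that (i) `(B, η)` is a universal pair for `(A, A)`, and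
(ii) for every commutative `K`-bialgebra `C` and every coaction `ψ : A → A ⊗ C` there is a
unique bialgebra homomorphism `Φ : B → C` with `ψ = (id_A ⊗ Φ) ∘ η`.
-/

open TensorProduct

universe u

/-- `(C₀, η)` is a universal pair for `(A, B)`. -/
def IsUniversalAlgPair (K : Type u) [Field K]
    (A : Type u) [NonUnitalRing A] [Module K A] [SMulCommClass K A A] [IsScalarTower K A A]
    (B : Type u) [NonUnitalRing B] [Module K B] [SMulCommClass K B B] [IsScalarTower K B B]
    (C₀ : Type u) [CommRing C₀] [Algebra K C₀]
    (η : B →ₙₐ[K] A ⊗[K] C₀) : Prop :=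
  ∀ (C : Type u) [CommRing C] [Algebra K C], ∀ f : B →ₙₐ[K] A ⊗[K] C,
    ∃! Φ : C₀ →ₐ[K] C, ∀ x : B, f x = LinearMap.lTensor A Φ.toLinearMap (η x)

/-- A coaction of a commutative `K`-bialgebra `B` on the non-unital associative algebra `A`:
a non-unital algebra homomorphism `η : A → A ⊗ B` making `A` a right `B`-comodule. -/
def IsAlgCoaction (K : Type u) [Field K]
    (A : Type u) [NonUnitalRing A] [Module K A] [SMulCommClass K A A] [IsScalarTower K A A]
    (B : Type u) [CommRing B] [Bialgebra K B]
    (η : A →ₙₐ[K] A ⊗[K] B) : Prop :=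
  (∀ a : A, TensorProduct.rid K A
      (LinearMap.lTensor A (Coalgebra.counit (R := K) (A := B)) (η a)) = a) ∧
  ∀ a : A, LinearMap.lTensor A (Coalgebra.comul (R := K) (A := B)) (η a) =
    TensorProduct.assoc K A B B (LinearMap.rTensor B (η : A →ₗ[K] A ⊗[K] B) (η a))

/-- A universal coacting bialgebra of `A`: a commutative `K`-bialgebra `B` with a coaction
`η : A → A ⊗ B` which is a universal pair for `(A, A)` and is initial among coactions of
commutative bialgebras on `A`. -/
structure UniversalAlgCoactingBialgebra (K : Type u) [Field K]
    (A : Type u) [NonUnitalRing A] [Module K A] [SMulCommClass K A A] [IsScalarTower K A A] :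
    Type (u + 1) where
  B : Type u
  [commRingB : CommRing B]
  [bialgebraB : Bialgebra K B]
  η : A →ₙₐ[K] A ⊗[K] B
  coaction : IsAlgCoaction K A B η
  universal_alg : IsUniversalAlgPair K A A B η
  universal_bialg : ∀ (C : Type u) [CommRing C] [Bialgebra K C], ∀ ψ : A →ₙₐ[K] A ⊗[K] C,
    IsAlgCoaction K A C ψ →
    ∃! Φ : B →ₐc[K] C, ∀ a : A, ψ a = LinearMap.lTensor A Φ.toLinearMap (η a)

namespace TensorProduct

section Coord

variable {K A C D ι : Type*} [CommRing K] [AddCommGroup A] [Module K A]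
  [AddCommGroup C] [Module K C] [AddCommGroup D] [Module K D]

/-- The `i`-th coordinate of an element of `A ⊗ C` with respect to a basis of `A`. -/
noncomputable def basisCoord (b : Module.Basis ι K A) (i : ι) : A ⊗[K] C →ₗ[K] C :=
  TensorProduct.lid K C ∘ₗ LinearMap.rTensor C (b.coord i)

@[simp]
lemma basisCoord_tmul (b : Module.Basis ι K A) (i : ι) (a : A) (c : C) :
    basisCoord b i (a ⊗ₜ[K] c) = b.coord i a • c := by
  simp [basisCoord]

lemma sum_tmul_basisCoord [Fintype ι] (b : Module.Basis ι K A) (z : A ⊗[K] C) :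
    ∑ i, b i ⊗ₜ[K] basisCoord b i z = z := by
  induction z with
  | zero => simp
  | tmul a c =>
    simp only [basisCoord_tmul, ← TensorProduct.smul_tmul, ← TensorProduct.sum_tmul,
      Module.Basis.coord_apply, b.sum_repr]
  | add z w hz hw => simp only [map_add, tmul_add, Finset.sum_add_distrib, hz, hw]

lemma ext_basisCoord [Fintype ι] (b : Module.Basis ι K A) {z w : A ⊗[K] C}
    (h : ∀ i, basisCoord b i z = basisCoord b i w) : z = w := by
  rw [← sum_tmul_basisCoord b z, ← sum_tmul_basisCoord b w]
  simp only [h]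

lemma basisCoord_lTensor (b : Module.Basis ι K A) (i : ι) (φ : C →ₗ[K] D) (z : A ⊗[K] C) :
    basisCoord b i (LinearMap.lTensor A φ z) = φ (basisCoord b i z) := by
  induction z with
  | zero => simp
  | tmul a c => simp
  | add z w hz hw => simp only [map_add, hz, hw]

lemma basisCoord_assoc (b : Module.Basis ι K A) (i : ι) (z : A ⊗[K] C) (d : D) :
    basisCoord b i (TensorProduct.assoc K A C D (z ⊗ₜ[K] d)) = basisCoord b i z ⊗ₜ[K] d := by
  induction z with
  | zero => simp
  | tmul a c => simp [TensorProduct.smul_tmul']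
  | add z w hz hw => simp only [map_add, hz, hw, add_tmul]

/-- Coordinates of the composite `A → A ⊗ D → (A ⊗ C) ⊗ D → A ⊗ (C ⊗ D)`: they multiply
like matrices. -/
lemma basisCoord_assoc_rTensor [Fintype ι] (b : Module.Basis ι K A) (i : ι)
    (f : A →ₗ[K] A ⊗[K] C) (z : A ⊗[K] D) :
    basisCoord b i (TensorProduct.assoc K A C D (LinearMap.rTensor D f z)) =
      ∑ k, basisCoord b i (f (b k)) ⊗ₜ[K] basisCoord b k z := by
  conv_lhs => rw [← sum_tmul_basisCoord b z]
  simp only [map_sum, LinearMap.rTensor_tmul, basisCoord_assoc]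

end Coord

section Mul

variable {K A C D : Type*} [CommRing K] [NonUnitalRing A] [Module K A] [SMulCommClass K A A]
  [IsScalarTower K A A] [CommRing C] [Algebra K C] [CommRing D] [Algebra K D]

lemma lTensor_algHom_mul (φ : C →ₐ[K] D) (z w : A ⊗[K] C) :
    LinearMap.lTensor A φ.toLinearMap (z * w) =
      LinearMap.lTensor A φ.toLinearMap z * LinearMap.lTensor A φ.toLinearMap w := by
  induction z with
  | zero => simp
  | add z z' hz hz' => simp only [add_mul, map_add, hz, hz']
  | tmul a c =>
    induction w with
    | zero => simp
    | add w w' hw hw' => simp only [mul_add, map_add, hw, hw']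
    | tmul a' c' => simp [Algebra.TensorProduct.tmul_mul_tmul]

lemma assoc_mul_tmul_mul (x y : A ⊗[K] C) (d e : D) :
    TensorProduct.assoc K A C D ((x * y) ⊗ₜ[K] (d * e)) =
      TensorProduct.assoc K A C D (x ⊗ₜ[K] d) * TensorProduct.assoc K A C D (y ⊗ₜ[K] e) := by
  induction x with
  | zero => simp
  | add x x' hx hx' => simp only [add_mul, add_tmul, map_add, hx, hx']
  | tmul a c =>
    induction y with
    | zero => simp
    | add y y' hy hy' => simp only [mul_add, add_tmul, map_add, hy, hy']
    | tmul a' c' => simp [Algebra.TensorProduct.tmul_mul_tmul]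

lemma assoc_rTensor_mul {B : Type*} [NonUnitalRing B] [Module K B] [SMulCommClass K B B]
    [IsScalarTower K B B] (f : B →ₙₐ[K] A ⊗[K] C) (z w : B ⊗[K] D) :
    TensorProduct.assoc K A C D (LinearMap.rTensor D (f : B →ₗ[K] A ⊗[K] C) (z * w)) =
      TensorProduct.assoc K A C D (LinearMap.rTensor D (f : B →ₗ[K] A ⊗[K] C) z) *
        TensorProduct.assoc K A C D (LinearMap.rTensor D (f : B →ₗ[K] A ⊗[K] C) w) := by
  induction z with
  | zero => simp
  | add z z' hz hz' => simp only [add_mul, map_add, hz, hz']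
  | tmul a d =>
    induction w with
    | zero => simp
    | add w w' hw hw' => simp only [mul_add, map_add, hw, hw']
    | tmul a' d' =>
      simpa [Algebra.TensorProduct.tmul_mul_tmul] using assoc_mul_tmul_mul (f a) (f a') d d'

end Mul

end TensorProduct

open TensorProduct

section Universal

variable (K : Type u) [Field K]
  (A : Type u) [NonUnitalRing A] [Module K A] [SMulCommClass K A A] [IsScalarTower K A A]

/-- A universal pair for `(A, B)` exists as soon as `A` is finite-dimensional. -/
theorem exists_isUniversalAlgPair [FiniteDimensional K A]
    (B : Type u) [NonUnitalRing B] [Module K B] [SMulCommClass K B B] [IsScalarTower K B B] :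
    ∃ (C₀ : Type u) (_ : CommRing C₀) (_ : Algebra K C₀) (η : B →ₙₐ[K] A ⊗[K] C₀),
      IsUniversalAlgPair K A B C₀ η := by
  let b := Module.finBasis K A
  let e := Module.Basis.ofVectorSpace K B
  let P := MvPolynomial (Fin (Module.finrank K A) × Module.Basis.ofVectorSpaceIndex K B) K
  let g : B →ₗ[K] A ⊗[K] P := e.constr K fun j ↦ ∑ i, b i ⊗ₜ[K] MvPolynomial.X (i, j)
  have g_basis (j) : g (e j) = ∑ i, b i ⊗ₜ[K] (MvPolynomial.X (i, j) : P) := by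
    simp only [g, Module.Basis.constr_basis]
  let I : Ideal P := Ideal.span
    (Set.range fun t : B × B × Fin (Module.finrank K A) ↦
      basisCoord b t.2.2 (g (t.1 * t.2.1) - g t.1 * g t.2.1))
  let π : P →ₐ[K] P ⧸ I := Ideal.Quotient.mkₐ K I
  let η : B →ₙₐ[K] A ⊗[K] (P ⧸ I) :=
    { toFun := fun x ↦ LinearMap.lTensor A π.toLinearMap (g x)
      map_smul' := fun r x ↦ by simp
      map_zero' := by simp
      map_add' := fun x y ↦ by simp
      map_mul' := fun x y ↦ by
        rw [← lTensor_algHom_mul, ← sub_eq_zero, ← map_sub]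
        refine ext_basisCoord b fun k ↦ ?_
        rw [basisCoord_lTensor, map_zero]
        exact Ideal.Quotient.eq_zero_iff_mem.mpr (Ideal.subset_span ⟨(x, y, k), rfl⟩) }
  have η_apply (x) : η x = LinearMap.lTensor A π.toLinearMap (g x) := rfl
  refine ⟨P ⧸ I, inferInstance, inferInstance, η, fun C _ _ f ↦ ?_⟩
  let φ : P →ₐ[K] C := MvPolynomial.aeval fun t ↦ basisCoord b t.1 (f (e t.2))
  have φ_X (t) : φ (MvPolynomial.X t) = basisCoord b t.1 (f (e t.2)) :=
    MvPolynomial.aeval_X _ t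
  have hφ : LinearMap.lTensor A φ.toLinearMap ∘ₗ g = (f : B →ₗ[K] A ⊗[K] C) := by
    refine e.ext fun j ↦ ?_
    simp only [LinearMap.comp_apply, g_basis, map_sum, LinearMap.lTensor_tmul]
    simp only [AlgHom.toLinearMap_apply, φ_X]
    exact sum_tmul_basisCoord b (f (e j))
  have hφ' (x) : LinearMap.lTensor A φ.toLinearMap (g x) = f x := LinearMap.congr_fun hφ x
  have hI : ∀ p ∈ I, φ p = 0 := by
    intro p hp
    refine (Ideal.span_le (I := RingHom.ker φ)).mpr ?_ hp
    rintro _ ⟨⟨x, y, k⟩, rfl⟩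
    change φ.toLinearMap _ = 0
    rw [← basisCoord_lTensor, map_sub, lTensor_algHom_mul, hφ', hφ', hφ', map_mul, sub_self,
      map_zero]
  refine ⟨Ideal.Quotient.liftₐ I φ hI, fun x ↦ ?_, fun Ψ hΨ ↦ ?_⟩
  · rw [η_apply, ← hφ', ← LinearMap.lTensor_comp_apply]
    rfl
  · refine Ideal.Quotient.algHom_ext _ (MvPolynomial.algHom_ext fun t ↦ ?_)
    have h := hΨ (e t.2)
    rw [η_apply, ← LinearMap.lTensor_comp_apply, g_basis] at h
    have h' := congrArg (basisCoord b t.1) h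
    simp only [map_sum, LinearMap.lTensor_tmul, basisCoord_tmul, Module.Basis.coord_apply,
      Module.Basis.repr_self, Finsupp.single_apply, ite_smul, one_smul, zero_smul,
      Finset.sum_ite_eq', Finset.mem_univ, if_true] at h'
    exact h'.symm.trans (φ_X t).symm

variable {K A}

/-- Algebra homomorphisms out of a universal algebra are determined by their values on the
coefficients of the universal map. -/
lemma IsUniversalAlgPair.algHom_ext {ι : Type*} [Fintype ι] {B C₀ C : Type u}
    [NonUnitalRing B] [Module K B] [SMulCommClass K B B] [IsScalarTower K B B]
    [CommRing C₀] [Algebra K C₀] [CommRing C] [Algebra K C]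
    {η : B →ₙₐ[K] A ⊗[K] C₀} (hη : IsUniversalAlgPair K A B C₀ η) (b : Module.Basis ι K A)
    {κ : Type*} (e : Module.Basis κ K B)
    {φ ψ : C₀ →ₐ[K] C}
    (h : ∀ i j, φ (basisCoord b i (η (e j))) = ψ (basisCoord b i (η (e j)))) : φ = ψ := by
  let f : B →ₙₐ[K] A ⊗[K] C :=
    { toFun := fun x ↦ LinearMap.lTensor A φ.toLinearMap (η x)
      map_smul' := fun r x ↦ by simp
      map_zero' := by simp
      map_add' := fun x y ↦ by simp
      map_mul' := fun x y ↦ by rw [map_mul, lTensor_algHom_mul] }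
  refine (hη C f).unique (fun _ ↦ rfl) fun x ↦ ?_
  refine LinearMap.congr_fun (f := (f : B →ₗ[K] A ⊗[K] C))
    (g := LinearMap.lTensor A ψ.toLinearMap ∘ₗ (η : B →ₗ[K] A ⊗[K] C₀)) (e.ext fun j ↦ ?_) x
  refine ext_basisCoord b fun i ↦ ?_
  exact (basisCoord_lTensor b i φ.toLinearMap _).trans
    ((h i j).trans (basisCoord_lTensor b i ψ.toLinearMap _).symm)

/-- The algebra of a universal pair for `(A, A)` is a bialgebra universally coacting on `A`. -/
theorem IsUniversalAlgPair.nonempty_universalAlgCoactingBialgebra [FiniteDimensional K A]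
    {B : Type u} [CommRing B] [Algebra K B] {η : A →ₙₐ[K] A ⊗[K] B}
    (hη : IsUniversalAlgPair K A A B η) :
    Nonempty (UniversalAlgCoactingBialgebra K A) := by
  let b := Module.finBasis K A
  let x (i j) : B := basisCoord b i (η (b j))
  let F : A →ₙₐ[K] A ⊗[K] (B ⊗[K] B) :=
    { toFun := fun a ↦ TensorProduct.assoc K A B B
        (LinearMap.rTensor B (η : A →ₗ[K] A ⊗[K] B) (η a))
      map_smul' := fun r x ↦ by simp
      map_zero' := by simp
      map_add' := fun x y ↦ by simp
      map_mul' := fun x y ↦ by rw [map_mul, assoc_rTensor_mul] }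
  let G : A →ₙₐ[K] A ⊗[K] K :=
    { toFun := fun a ↦ a ⊗ₜ[K] 1
      map_smul' := fun r x ↦ rfl
      map_zero' := by simp
      map_add' := fun x y ↦ add_tmul _ _ _
      map_mul' := fun x y ↦ by simp [Algebra.TensorProduct.tmul_mul_tmul] }
  obtain ⟨Δ, hΔ, -⟩ := hη _ F
  obtain ⟨ε, hε, -⟩ := hη _ G
  have hΔx (i j) : Δ (x i j) = ∑ k, x i k ⊗ₜ[K] x k j :=
    (basisCoord_lTensor b i Δ.toLinearMap (η (b j))).symm.trans <|
      (congrArg (basisCoord b i) (hΔ (b j)).symm).trans <|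
        basisCoord_assoc_rTensor b i (η : A →ₗ[K] A ⊗[K] B) (η (b j))
  have hεx (i j) : ε (x i j) = if j = i then 1 else 0 := by
    refine (basisCoord_lTensor b i ε.toLinearMap (η (b j))).symm.trans <|
      (congrArg (basisCoord b i) (hε (b j)).symm).trans ?_
    change basisCoord b i (b j ⊗ₜ[K] (1 : K)) = _
    simp [Finsupp.single_apply]
  let _ : Bialgebra K B := Bialgebra.ofAlgHom Δ ε
    (hη.algHom_ext b b fun i j ↦ by
      change Algebra.TensorProduct.assoc K K K B B B
        (Algebra.TensorProduct.map Δ (.id K B) (Δ (x i j))) =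
          Algebra.TensorProduct.map (.id K B) Δ (Δ (x i j))
      simp only [hΔx, map_sum, Algebra.TensorProduct.map_tmul, AlgHom.id_apply, sum_tmul,
        tmul_sum, Algebra.TensorProduct.assoc_tmul]
      exact Finset.sum_comm)
    (hη.algHom_ext b b fun i j ↦ by
      change Algebra.TensorProduct.map ε (.id K B) (Δ (x i j)) = 1 ⊗ₜ[K] x i j
      simp [hΔx, hεx, ite_tmul])
    (hη.algHom_ext b b fun i j ↦ by
      change Algebra.TensorProduct.map (.id K B) ε (Δ (x i j)) = x i j ⊗ₜ[K] 1
      simp [hΔx, hεx, tmul_ite])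
  have comul_eq : (Coalgebra.comul : B →ₗ[K] B ⊗[K] B) = Δ.toLinearMap := rfl
  have counit_eq : (Coalgebra.counit : B →ₗ[K] K) = ε.toLinearMap := rfl
  refine ⟨⟨B, η, ⟨fun a ↦ ?_, fun a ↦ ?_⟩, hη, fun C _ _ ψ hψ ↦ ?_⟩⟩
  · rw [counit_eq, ← hε]
    exact (TensorProduct.rid_tmul a (1 : K)).trans (one_smul K a)
  · rw [comul_eq, ← hΔ]
    rfl
  · obtain ⟨Φ, hΦ, hΦu⟩ := hη C ψ
    have hΦx (i j) : basisCoord b i (ψ (b j)) = Φ (x i j) := by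
      rw [hΦ, basisCoord_lTensor]
      rfl
    refine ⟨BialgHom.ofAlgHom Φ ?_ ?_, hΦ, fun Ψ hΨ ↦ ?_⟩
    · refine hη.algHom_ext b b fun i j ↦ ?_
      change Coalgebra.counit (R := K) (Φ (x i j)) = ε (x i j)
      have h := congrArg (TensorProduct.rid K A).symm (hψ.1 (b j))
      rw [LinearEquiv.symm_apply_apply] at h
      rw [← hΦx, ← basisCoord_lTensor, h, hεx]
      simp [Finsupp.single_apply]
    · refine hη.algHom_ext b b fun i j ↦ ?_
      change Algebra.TensorProduct.map Φ Φ (Δ (x i j)) =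
        Coalgebra.comul (R := K) (Φ (x i j))
      rw [← hΦx, ← basisCoord_lTensor, hψ.2, basisCoord_assoc_rTensor]
      simp [hΔx, ← hΦx]
    · have := hΦu (Ψ : B →ₐ[K] C) hΨ
      ext t
      exact DFunLike.congr_fun this t

end Universal

/-- Every finite-dimensional non-unital associative algebra over a field of characteristic
zero admits a universal coacting bialgebra. -/
theorem exists_universalAlgCoactingBialgebra
    (K : Type u) [Field K] [CharZero K]
    (A : Type u) [NonUnitalRing A] [Module K A] [SMulCommClass K A A] [IsScalarTower K A A]
    [FiniteDimensional K A] :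
    Nonempty (UniversalAlgCoactingBialgebra K A) := by
  obtain ⟨B, _, _, η, hη⟩ := exists_isUniversalAlgPair K A A
  exact hη.nonempty_universalAlgCoactingBialgebra
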